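/- Let f ∈ 𝔪² define an isolated hypersurface singularity (i.e. μ(f) < ∞). Then the images of the partial derivatives ∂f/∂x₁,…,∂f/∂xₙ in O/(𝔪·J(f)) are linearly independent over ℂ, and consequently dim_ℂ O/(𝔪·J(f)) = μ(f) + n, where 𝔪·J(f) denotes the product ideal (x₁,…,xₙ)·(∂f/∂x₁,…,∂f/∂xₙ). -/

import Mathlib

/-- Formal partial derivative of a multivariate power series with respect to variable `i`. -/
noncomputable def pd {n : ℕ} {R : Type*} [CommSemiring R] (i : Fin n)
    (f : MvPowerSeries (Fin n) R) : MvPowerSeries (Fin n) R :=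
  fun m => (m i + 1) • f (m + Finsupp.single i 1)

/-- The maximal ideal `(x₁, …, xₙ)` of `ℂ[[x₁,…,xₙ]]`. -/
noncomputable def mIdeal (n : ℕ) : Ideal (MvPowerSeries (Fin n) ℂ) :=
  Ideal.span (Set.range (MvPowerSeries.X : Fin n → MvPowerSeries (Fin n) ℂ))

/-- The Jacobian ideal `J(f) = (∂f/∂x₁, …, ∂f/∂xₙ)` of `f ∈ ℂ[[x₁,…,xₙ]]`. -/
noncomputable def jacIdeal {n : ℕ} (f : MvPowerSeries (Fin n) ℂ) :
    Ideal (MvPowerSeries (Fin n) ℂ) :=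
  Ideal.span (Set.range fun i : Fin n => pd i f)

theorem natCast_le_ringKrullDim_mvPowerSeries (R : Type*) [CommRing R] [Nontrivial R] (n : ℕ) :
    (n : WithBot ℕ∞) ≤ ringKrullDim (MvPowerSeries (Fin n) R) := by
  induction n with
  | zero => simpa using ringKrullDim_nonneg_of_nontrivial (R := MvPowerSeries (Fin 0) R)
  | succ n ih =>
    rw [ringKrullDim_eq_of_ringEquiv (MvPowerSeries.finSuccEquiv R n).toRingEquiv]
    refine le_trans ?_ ringKrullDim_succ_le_ringKrullDim_powerseries
    push_cast
    gcongr

theorem mem_mIdeal_iff {n : ℕ} {a : MvPowerSeries (Fin n) ℂ} :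
    a ∈ mIdeal n ↔ MvPowerSeries.constantCoeff a = 0 := by
  refine ⟨fun ha => ?_, fun ha => ?_⟩
  · have hle : mIdeal n ≤ RingHom.ker (MvPowerSeries.constantCoeff (σ := Fin n) (R := ℂ)) :=
      Ideal.span_le.mpr (Set.range_subset_iff.mpr fun i => MvPowerSeries.constantCoeff_X i)
    exact hle ha
  induction n with
  | zero =>
    have h : a = 0 := by
      ext m
      rw [Subsingleton.elim m 0]
      simpa using ha
    exact h ▸ Ideal.zero_mem _
  | succ n ih =>
    let e := MvPowerSeries.finSuccEquiv ℂ n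
    let r := PowerSeries.constantCoeff (e a)
    have hr : r ∈ mIdeal n := ih (by
      have h := MvPowerSeries.coeff_coeff_finSuccEquiv (R := ℂ) a (k := 0) (x := 0)
      rw [Finsupp.cons_zero_zero] at h
      simpa [ha] using h)
    have hC : e.symm (PowerSeries.C r) ∈ mIdeal (n + 1) := by
      have hle : mIdeal n ≤ (mIdeal (n + 1)).comap
          ((e.symm : _ →+* MvPowerSeries (Fin (n + 1)) ℂ).comp PowerSeries.C) := by
        refine Ideal.span_le.mpr (Set.range_subset_iff.mpr fun j => ?_)
        have h : e.symm (PowerSeries.C (MvPowerSeries.X j)) = MvPowerSeries.X j.succ := by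
          rw [AlgEquiv.symm_apply_eq, MvPowerSeries.finSuccEquiv_X_succ]
        change e.symm (PowerSeries.C (MvPowerSeries.X j)) ∈ mIdeal (n + 1)
        exact h ▸ Ideal.subset_span ⟨j.succ, rfl⟩
      exact hle hr
    have hX : e.symm PowerSeries.X = MvPowerSeries.X 0 := by
      rw [AlgEquiv.symm_apply_eq, MvPowerSeries.finSuccEquiv_X_zero]
    rw [← e.symm_apply_apply a, PowerSeries.eq_X_mul_shift_add_const (e a), map_add, map_mul, hX]
    exact Ideal.add_mem _ (Ideal.mul_mem_right _ _ (Ideal.subset_span ⟨0, rfl⟩)) hC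

theorem maximalIdeal_eq_mIdeal (n : ℕ) :
    IsLocalRing.maximalIdeal (MvPowerSeries (Fin n) ℂ) = mIdeal n := by
  ext a
  rw [mem_mIdeal_iff, IsLocalRing.mem_maximalIdeal, mem_nonunits_iff,
    MvPowerSeries.isUnit_iff_constantCoeff, isUnit_iff_ne_zero, not_not]

theorem coeff_single_eq_zero_of_mem_sq {n : ℕ} {f : MvPowerSeries (Fin n) ℂ}
    (hf : f ∈ mIdeal n ^ 2) (i : Fin n) :
    MvPowerSeries.coeff (Finsupp.single i 1) f = 0 := by
  classical
  rw [pow_two] at hf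
  refine Submodule.mul_induction_on hf (fun a ha b hb => ?_) fun a b ha hb => by simp [ha, hb]
  rw [mem_mIdeal_iff] at ha hb
  rw [MvPowerSeries.coeff_mul, Finsupp.antidiagonal_single]
  simp [Finset.Nat.antidiagonal_succ, ha, hb]

theorem pd_mem_mIdeal {n : ℕ} {f : MvPowerSeries (Fin n) ℂ} (hf : f ∈ mIdeal n ^ 2)
    (i : Fin n) : pd i f ∈ mIdeal n := by
  rw [mem_mIdeal_iff, ← MvPowerSeries.coeff_zero_eq_constantCoeff_apply]
  have h := coeff_single_eq_zero_of_mem_sq hf i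
  simpa [MvPowerSeries.coeff_apply, pd] using h

/-- A proper ideal of finite colength in `ℂ[[x₁,…,xₙ]]` needs at least `n` generators. -/
theorem le_card_of_finite_quotient_span {n : ℕ} (s : Finset (MvPowerSeries (Fin n) ℂ))
    (hs : Ideal.span (s : Set (MvPowerSeries (Fin n) ℂ)) ≠ ⊤)
    [Module.Finite ℂ (MvPowerSeries (Fin n) ℂ ⧸ Ideal.span (s : Set (MvPowerSeries (Fin n) ℂ)))] :
    n ≤ s.card := by
  obtain ⟨P, hP⟩ := Ideal.nonempty_minimalPrimes hs
  have hPp : P.IsPrime := hP.isPrime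
  have hfin : Module.Finite ℂ (MvPowerSeries (Fin n) ℂ ⧸ P) :=
    Module.Finite.of_surjective (Ideal.Quotient.factorₐ ℂ hP.le).toLinearMap
      (Ideal.Quotient.factor_surjective hP.le)
  have : IsArtinianRing (MvPowerSeries (Fin n) ℂ ⧸ P) := IsArtinianRing.of_finite ℂ _
  have hmax : P.IsMaximal :=
    Ideal.Quotient.maximal_of_isField P (IsArtinianRing.isField_of_isDomain _)
  have hht := Ideal.height_le_card_of_mem_minimalPrimes_span_finset hP
  rw [IsLocalRing.eq_maximalIdeal hmax] at hht
  have hdim := natCast_le_ringKrullDim_mvPowerSeries ℂ n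
  rw [← IsLocalRing.maximalIdeal_height_eq_ringKrullDim] at hdim
  exact_mod_cast (WithBot.coe_le_coe.mp hdim).trans hht

/-- If a ℂ-linear combination of generators with a nonzero coefficient lies in `𝔪 * J`,
the corresponding generator is redundant. -/
theorem span_image_erase_eq_of_sum_mem {n : ℕ} {ι : Type*} [Fintype ι] [DecidableEq ι]
    (v : ι → MvPowerSeries (Fin n) ℂ) {c : ι → ℂ} {j : ι} (hj : c j ≠ 0)
    (h : ∑ i, c i • v i ∈ mIdeal n * Ideal.span (Set.range v)) :
    Ideal.span (v '' {j}ᶜ) = Ideal.span (Set.range v) := by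
  have hle : Ideal.span (v '' {j}ᶜ) ≤ Ideal.span (Set.range v) :=
    Ideal.span_mono (Set.image_subset_range _ _)
  refine le_antisymm hle ?_
  refine Submodule.le_of_le_smul_of_le_jacobson_bot (I := mIdeal n)
    (Submodule.fg_span (Set.finite_range v)) ?_ ?_
  · rw [IsLocalRing.jacobson_eq_maximalIdeal ⊥ bot_ne_top, maximalIdeal_eq_mIdeal]
  have hmem : ∀ i, i ≠ j → v i ∈ Ideal.span (v '' {j}ᶜ) := fun i hi =>
    Ideal.subset_span ⟨i, hi, rfl⟩
  refine Ideal.span_le.mpr ?_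
  rintro _ ⟨i, rfl⟩
  rcases eq_or_ne i j with rfl | hi
  · rw [← Finset.add_sum_erase _ _ (Finset.mem_univ i)] at h
    have hs : ∑ k ∈ Finset.univ.erase i, c k • v k ∈ Ideal.span (v '' {i}ᶜ) :=
      Submodule.sum_mem _ fun k hk =>
        Submodule.smul_of_tower_mem _ _ (hmem k (Finset.ne_of_mem_erase hk))
    have hv : c i • v i ∈ Ideal.span (v '' {i}ᶜ) ⊔ mIdeal n • Ideal.span (Set.range v) := by
      have := Submodule.sub_mem _ (Submodule.mem_sup_right h) (Submodule.mem_sup_left hs)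
      simpa using this
    simpa [smul_smul, hj] using Submodule.smul_of_tower_mem _ (c i)⁻¹ hv
  · exact Submodule.mem_sup_left (hmem i hi)

theorem linearIndependent_mk_mul_span {n : ℕ} (v : Fin n → MvPowerSeries (Fin n) ℂ)
    (hv : ∀ i, v i ∈ mIdeal n)
    [Module.Finite ℂ (MvPowerSeries (Fin n) ℂ ⧸ Ideal.span (Set.range v))] :
    LinearIndependent ℂ
      fun i => Ideal.Quotient.mk (mIdeal n * Ideal.span (Set.range v)) (v i) := by
  classical
  rw [Fintype.linearIndependent_iff]
  intro c hc j
  by_contra hj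
  have hmem : ∑ i, c i • v i ∈ mIdeal n * Ideal.span (Set.range v) := by
    rw [← Ideal.Quotient.eq_zero_iff_mem, ← hc, map_sum]
    rfl
  have hspan := span_image_erase_eq_of_sum_mem v hj hmem
  have hset : ((Finset.univ.erase j).image v : Set _) = v '' {j}ᶜ := by
    simp [Set.compl_eq_univ_sdiff]
  rw [← hset] at hspan
  have hne : Ideal.span (Set.range v) ≠ ⊤ := by
    refine ne_top_of_le_ne_top
      (Ideal.IsPrime.ne_top' (I := IsLocalRing.maximalIdeal (MvPowerSeries (Fin n) ℂ))) ?_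
    rw [maximalIdeal_eq_mIdeal]
    exact Ideal.span_le.mpr (Set.range_subset_iff.mpr hv)
  have : Module.Finite ℂ (MvPowerSeries (Fin n) ℂ ⧸
      Ideal.span (((Finset.univ.erase j).image v :) : Set (MvPowerSeries (Fin n) ℂ))) := by
    rwa [hspan]
  have hcard := le_card_of_finite_quotient_span _ (hspan ▸ hne)
  have hlt : (Finset.univ.erase j).card < n := by
    simpa using Finset.card_erase_lt_of_mem (Finset.mem_univ j)
  exact absurd (hcard.trans Finset.card_image_le) hlt.not_ge

/-- Modulo `𝔪 * J`, the ideal `J` is spanned over ℂ by the images of its generators. -/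
theorem ker_factor_mul_span {n : ℕ} {ι : Type*} [Fintype ι] (v : ι → MvPowerSeries (Fin n) ℂ) :
    (Ideal.Quotient.factorₐ ℂ
      (Ideal.mul_le_right : mIdeal n * Ideal.span (Set.range v) ≤ _)).toLinearMap.ker =
    Submodule.span ℂ (Set.range
      fun i => Ideal.Quotient.mk (mIdeal n * Ideal.span (Set.range v)) (v i)) := by
  refine le_antisymm ?_ (Submodule.span_le.mpr ?_)
  · intro x hx
    obtain ⟨a, rfl⟩ := Ideal.Quotient.mk_surjective x
    have ha : a ∈ Ideal.span (Set.range v) := Ideal.Quotient.eq_zero_iff_mem.mp hx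
    obtain ⟨b, rfl⟩ := Ideal.mem_span_range_iff_exists_fun.mp ha
    rw [map_sum]
    refine Submodule.sum_mem _ fun i _ => ?_
    have h : Ideal.Quotient.mk (mIdeal n * Ideal.span (Set.range v)) (b i * v i) =
        MvPowerSeries.constantCoeff (b i) •
          Ideal.Quotient.mk (mIdeal n * Ideal.span (Set.range v)) (v i) := by
      change _ = Ideal.Quotient.mk _ (MvPowerSeries.constantCoeff (b i) • v i)
      rw [Ideal.Quotient.eq, MvPowerSeries.smul_eq_C_mul, ← sub_mul]
      exact Ideal.mul_mem_mul (mem_mIdeal_iff.mpr (by simp)) (Ideal.subset_span ⟨i, rfl⟩)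
    rw [h]
    exact Submodule.smul_mem _ _ (Submodule.subset_span ⟨i, rfl⟩)
  · rintro _ ⟨i, rfl⟩
    exact Ideal.Quotient.eq_zero_iff_mem.mpr (Ideal.subset_span ⟨i, rfl⟩)

theorem linearIndependent_and_finrank_quotient_mul_span {n : ℕ}
    (v : Fin n → MvPowerSeries (Fin n) ℂ) (hv : ∀ i, v i ∈ mIdeal n)
    (hfin : Module.Finite ℂ (MvPowerSeries (Fin n) ℂ ⧸ Ideal.span (Set.range v))) :
    LinearIndependent ℂ
      (fun i => Ideal.Quotient.mk (mIdeal n * Ideal.span (Set.range v)) (v i)) ∧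
    Module.Finite ℂ (MvPowerSeries (Fin n) ℂ ⧸ (mIdeal n * Ideal.span (Set.range v))) ∧
    Module.finrank ℂ (MvPowerSeries (Fin n) ℂ ⧸ (mIdeal n * Ideal.span (Set.range v))) =
      Module.finrank ℂ (MvPowerSeries (Fin n) ℂ ⧸ Ideal.span (Set.range v)) + n := by
  have hli := linearIndependent_mk_mul_span v hv
  have hker := ker_factor_mul_span v
  have hsurj : Function.Surjective (Ideal.Quotient.factorₐ ℂ
      (Ideal.mul_le_right : mIdeal n * Ideal.span (Set.range v) ≤ _)).toLinearMap :=
    Ideal.Quotient.factor_surjective Ideal.mul_le_right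
  generalize (Ideal.Quotient.factorₐ ℂ
      (Ideal.mul_le_right : mIdeal n * Ideal.span (Set.range v) ≤ _)).toLinearMap = φ
    at hker hsurj
  have hker_fin : Module.Finite ℂ φ.ker :=
    hker ▸ Module.Finite.span_of_finite ℂ (Set.finite_range _)
  have hquot_fin := Module.Finite.equiv (φ.quotKerEquivOfSurjective hsurj).symm
  have hmul_fin := Module.Finite.of_submodule_quotient φ.ker
  refine ⟨hli, hmul_fin, ?_⟩
  rw [← φ.finrank_range_add_finrank_ker, LinearMap.range_eq_top.mpr hsurj, finrank_top, hker,
    finrank_span_eq_card hli, Fintype.card_fin]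

/-- for `f ∈ 𝔪²` defining an isolated hypersurface singularity
(`μ(f) = dim_ℂ O/J(f) < ∞`), the images of the partial derivatives
`∂f/∂x₁, …, ∂f/∂xₙ` in `O/(𝔪·J(f))` are linearly independent over ℂ, and consequently
`dim_ℂ O/(𝔪·J(f)) = μ(f) + n`. -/
theorem partials_linearIndependent_mod_mJf (n : ℕ) (hn : 1 ≤ n)
    (f : MvPowerSeries (Fin n) ℂ)
    (hf2 : f ∈ (mIdeal n) ^ 2)
    (hmu : Module.Finite ℂ (MvPowerSeries (Fin n) ℂ ⧸ jacIdeal f)) :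
    LinearIndependent ℂ
      (fun i : Fin n =>
        Ideal.Quotient.mk (mIdeal n * jacIdeal f) (pd i f)) ∧
    Module.Finite ℂ (MvPowerSeries (Fin n) ℂ ⧸ (mIdeal n * jacIdeal f)) ∧
    Module.finrank ℂ (MvPowerSeries (Fin n) ℂ ⧸ (mIdeal n * jacIdeal f)) =
      Module.finrank ℂ (MvPowerSeries (Fin n) ℂ ⧸ jacIdeal f) + n := by
  exact linearIndependent_and_finrank_quotient_mul_span (fun i => pd i f) (pd_mem_mIdeal hf2) hmu
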